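/- Let q be a prime with q ≡ 1 (mod 4) or q = 2, and let s be an integer with q ∣ Φ₄(s), where Φ₄(x) = x² + 1. Define n₄(x) = q·x² + 2s·x + Φ₄(s)/q, p₄(x) = Φ₆(q·x + s) with Φ₆(x) = x² − x + 1, and t₄(x) = 1 − q·x − s. Then for every integer x: (i) q·n₄(x) = p₄(x) + 1 − t₄(x); (ii) q·n₄(x) divides Φ₄(p₄(x)); (iii) t₄(x)² − 4·p₄(x) ≤ 0. Moreover n₄ and p₄ are irreducible as polynomials over ℤ. -/

import Mathlib

open Polynomial

/-- The 4th cyclotomic polynomial, evaluated at an integer. -/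
def Phi4 (x : ℤ) : ℤ := x ^ 2 + 1

/-- The 6th cyclotomic polynomial, evaluated at an integer. -/
def Phi6 (x : ℤ) : ℤ := x ^ 2 - x + 1

/-- A primitive integral quadratic polynomial with negative discriminant is irreducible. -/
theorem irreducible_quadratic_of_discrim_neg {a b c : ℤ} (ha : a ≠ 0)
    (hd : discrim a b c < 0)
    (hprim : ∀ r : ℤ, r ∣ a → r ∣ b → r ∣ c → IsUnit r) :
    Irreducible (C a * X ^ 2 + C b * X + C c) := by
  have hdeg : (C a * X ^ 2 + C b * X + C c).natDegree = 2 := natDegree_quadratic ha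
  have hconst : ∀ g h : ℤ[X], C a * X ^ 2 + C b * X + C c = g * h → g.natDegree = 0 →
      IsUnit g := by
    intro g h hgh hg
    rw [eq_C_of_natDegree_eq_zero hg] at hgh ⊢
    have hdvd : ∀ n, g.coeff 0 ∣ (C a * X ^ 2 + C b * X + C c).coeff n :=
      (C_dvd_iff_dvd_coeff _ _).1 ⟨h, hgh⟩
    refine isUnit_C.2 (hprim _ ?_ ?_ ?_)
    · simpa [coeff_X, coeff_C, -eq_intCast] using hdvd 2
    · simpa [coeff_X, coeff_C, -eq_intCast] using hdvd 1
    · simpa [coeff_X, coeff_C, -eq_intCast] using hdvd 0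
  refine ⟨fun hu => ?_, fun g h hgh => ?_⟩
  · rw [natDegree_eq_zero_of_isUnit hu] at hdeg
    exact two_ne_zero hdeg.symm
  have hne : g * h ≠ 0 := by
    intro h0
    rw [hgh, h0, natDegree_zero] at hdeg
    exact two_ne_zero hdeg.symm
  have hsum : g.natDegree + h.natDegree = 2 := by
    rw [← natDegree_mul (left_ne_zero_of_mul hne) (right_ne_zero_of_mul hne), ← hgh, hdeg]
  by_cases hg : g.natDegree = 0
  · exact Or.inl (hconst g h hgh hg)
  by_cases hh : h.natDegree = 0
  · exact Or.inr (hconst h g (hgh.trans (mul_comm g h)) hh)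
  exfalso
  have hg1 : g.natDegree = 1 := by omega
  have hh1 : h.natDegree = 1 := by omega
  obtain ⟨u, -, v, rfl⟩ := natDegree_eq_one.1 hg1
  obtain ⟨w, -, z, rfl⟩ := natDegree_eq_one.1 hh1
  have hmul : (C u * X + C v) * (C w * X + C z) =
      C (u * w) * X ^ 2 + C (u * z + v * w) * X + C (v * z) := by
    simp only [map_mul, map_add]
    ring
  rw [hmul] at hgh
  have hcoeff := fun n => congrArg (coeff · n) hgh
  have h2 : a = u * w := by
    simpa [coeff_X, coeff_C, -eq_intCast, -map_mul, -map_add] using hcoeff 2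
  have h1 : b = u * z + v * w := by
    simpa [coeff_X, coeff_C, -eq_intCast, -map_mul, -map_add] using hcoeff 1
  have h0 : c = v * z := by
    simpa [coeff_X, coeff_C, -eq_intCast, -map_mul, -map_add] using hcoeff 0
  rw [discrim, h2, h1, h0] at hd
  nlinarith [sq_nonneg (u * z - v * w)]

theorem mnt_family_k4_case_phi4 (q : ℤ) (hq : Prime q) (hmod : q % 4 = 1 ∨ q = 2)
    (s : ℤ) (hdvd : q ∣ Phi4 s)
    (n4 : ℤ → ℤ) (hn4 : ∀ x, n4 x = q * x ^ 2 + 2 * s * x + Phi4 s / q)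
    (p4 : ℤ → ℤ) (hp4 : ∀ x, p4 x = Phi6 (q * x + s))
    (t4 : ℤ → ℤ) (ht4 : ∀ x, t4 x = 1 - q * x - s) :
    (∀ x : ℤ, q * n4 x = p4 x + 1 - t4 x) ∧
    (∀ x : ℤ, q * n4 x ∣ Phi4 (p4 x)) ∧
    (∀ x : ℤ, t4 x ^ 2 - 4 * p4 x ≤ 0) ∧
    Irreducible (C q * X ^ 2 + C (2 * s) * X + C (Phi4 s / q)) ∧
    Irreducible ((C q * X + C s) ^ 2 - (C q * X + C s) + 1) := by
  obtain ⟨k, hk⟩ := hdvd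
  have hq0 : q ≠ 0 := hq.ne_zero
  have hkq : Phi4 s / q = k := by rw [hk, Int.mul_ediv_cancel_left _ hq0]
  rw [hkq] at hn4 ⊢
  unfold Phi4 at hk
  have hqs : ¬ q ∣ s := fun hs => hq.not_dvd_one <| by
    have h : q ∣ s ^ 2 + 1 := ⟨k, hk⟩
    exact (Int.dvd_add_right (hs.trans (dvd_pow_self s two_ne_zero))).1 h
  have hmul : ∀ x, q * n4 x = (q * x + s) ^ 2 + 1 := fun x => by
    rw [hn4]
    linear_combination -hk
  refine ⟨fun x => ?_, fun x => ?_, fun x => ?_, ?_, ?_⟩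
  · rw [hmul, hp4, ht4, Phi6]
    ring
  · rw [hmul, hp4, Phi6, Phi4]
    exact ⟨(q * x + s) ^ 2 - 2 * (q * x + s) + 2, by ring⟩
  · rw [ht4, hp4, Phi6]
    nlinarith [sq_nonneg (q * x + s - 1), sq_nonneg (q * x + s)]
  · refine irreducible_quadratic_of_discrim_neg hq0 ?_ fun r hrq hrs hrk => ?_
    · rw [discrim]
      linarith
    · refine (hq.irreducible.dvd_iff.1 hrq).resolve_right fun hassoc => ?_
      rcases hq.dvd_or_dvd (hassoc.dvd.trans hrs) with h2 | hs
      · have hq2 : q = 2 := by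
          have := Int.le_of_dvd two_pos h2
          have := Int.le_of_dvd two_pos ((neg_dvd).2 h2)
          have : q = -2 ∨ q = -1 ∨ q = 0 ∨ q = 1 ∨ q = 2 := by omega
          rcases this with rfl | rfl | rfl | rfl | rfl
          · omega
          · omega
          · omega
          · exact absurd hq not_prime_one
          · rfl
        subst hq2
        obtain ⟨l, rfl⟩ := hassoc.dvd.trans hrk
        rcases Int.even_or_odd' s with ⟨m, rfl | rfl⟩
        · exact hqs ⟨m, rfl⟩
        · ring_nf at hk
          omega
      · exact hqs hs
  · have hpoly : (C q * X + C s) ^ 2 - (C q * X + C s) + 1 =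
        C (q ^ 2) * X ^ 2 + C (q * (2 * s - 1)) * X + C (s ^ 2 - s + 1) := by
      simp only [map_mul, map_add, map_sub, map_pow, map_one, map_ofNat]
      ring
    rw [hpoly]
    refine irreducible_quadratic_of_discrim_neg (pow_ne_zero 2 hq0) ?_ fun r hrq _ hrs => ?_
    · have : 0 < q ^ 2 := by positivity
      rw [discrim]
      linarith
    · have hcop : IsCoprime (q ^ 2) (s ^ 2 - s + 1) := by
        refine IsCoprime.pow_left ((hq.irreducible.coprime_iff_not_dvd).2 fun h => hqs ?_)
        have h' : q ∣ s ^ 2 + 1 := ⟨k, hk⟩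
        have := dvd_sub h' h
        rwa [show s ^ 2 + 1 - (s ^ 2 - s + 1) = s by ring] at this
      exact hcop.isUnit_of_dvd' hrq hrs
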